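/- Let f : [a,b] → X be strongly McShane integrable on [a,b], let Z₁ = { t₁ ∈ [a₁,b₁] : the section f_{t₁} is not strongly McShane integrable on [a₂,b₂] }, Z₂ = { t₂ ∈ [a₂,b₂] : the section f_{t₂} is not strongly McShane integrable on [a₁,b₁] }, Z = (Z₁ × [a₂,b₂]) ∪ ([a₁,b₁] × Z₂), and f₀ = f·𝟙_{[a,b]∖Z}. Then the function g(t₁) = (M)∫_{[a₂,b₂]} (f₀)_{t₁}, t₁ ∈ [a₁,b₁], is strongly McShane integrable on [a₁,b₁] and (M)∫_{[a₁,b₁]} ((M)∫_{[a₂,b₂]} (f₀)_{t₁}) = (M)∫_{[a,b]} f. -/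

import Mathlib

open Set MeasureTheory

variable {E : Type*} [MeasureSpace E] [PseudoMetricSpace E] [Preorder E]
variable {X : Type*} [NormedAddCommGroup X] [NormedSpace ℝ X]

/-- The closed interval of a tagged item `(t, p, q)` is `[p, q]` (the tag is `t`). -/
def itemBox (x : E × E × E) : Set E := Set.Icc x.2.1 x.2.2

/-- `[p,q]` is a closed non-degenerate subinterval of `K`. -/
def IsSubinterval (K : Set E) (p q : E) : Prop :=
  Set.Icc p q ⊆ K ∧ (interior (Set.Icc p q)).Nonempty

/-- `P` is an `𝓜`-partition of `K`: a finite collection of tagged pairwise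
non-overlapping closed non-degenerate subintervals of `K` covering `K`, with tags in `K`. -/
def IsMPartition (K : Set E) (P : Finset (E × E × E)) : Prop :=
  (∀ x ∈ P, x.1 ∈ K ∧ IsSubinterval K x.2.1 x.2.2) ∧
  (∀ x ∈ P, ∀ y ∈ P, x ≠ y → interior (itemBox x) ∩ interior (itemBox y) = ∅) ∧
  (⋃ x ∈ P, itemBox x) = K

/-- `𝓗𝓚`-partition: an `𝓜`-partition each of whose tags belongs to its interval. -/
def IsHKPartition (K : Set E) (P : Finset (E × E × E)) : Prop :=
  IsMPartition K P ∧ ∀ x ∈ P, x.1 ∈ itemBox x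

/-- A gauge on `K`: positive on `K`. -/
def IsGauge (K : Set E) (δ : E → ℝ) : Prop := ∀ t ∈ K, 0 < δ t

/-- A tagged partition is `δ`-fine if each interval lies in the open ball
around its tag of radius `δ(tag)`. -/
def IsFine (δ : E → ℝ) (P : Finset (E × E × E)) : Prop :=
  ∀ x ∈ P, itemBox x ⊆ Metric.ball x.1 (δ x.1)

/-- `f` is McShane integrable on `K` with integral `v`. -/
def HasMcShaneIntegral (K : Set E) (f : E → X) (v : X) : Prop :=
  ∀ ε > 0, ∃ δ : E → ℝ, IsGauge K δ ∧
    ∀ P : Finset (E × E × E), IsMPartition K P → IsFine δ P →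
      ‖(∑ x ∈ P, (volume (itemBox x)).toReal • f x.1) - v‖ < ε

/-- `f` is Henstock–Kurzweil integrable on `K` with integral `v`. -/
def HasHKIntegral (K : Set E) (f : E → X) (v : X) : Prop :=
  ∀ ε > 0, ∃ δ : E → ℝ, IsGauge K δ ∧
    ∀ P : Finset (E × E × E), IsHKPartition K P → IsFine δ P →
      ‖(∑ x ∈ P, (volume (itemBox x)).toReal • f x.1) - v‖ < ε

/-- An additive interval function on the non-degenerate closed subintervals of `K`
(an interval is recorded by its pair of corners). -/
def IsAdditiveIntervalFun (K : Set E) (F : E × E → X) : Prop :=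
  ∀ p q r s u w : E, IsSubinterval K p q → IsSubinterval K r s → IsSubinterval K u w →
    interior (Set.Icc p q) ∩ interior (Set.Icc r s) = ∅ →
    Set.Icc p q ∪ Set.Icc r s = Set.Icc u w →
    F (u, w) = F (p, q) + F (r, s)

/-- `f` is strongly McShane integrable on `[a,b]` with `(M)∫_{[a,b]} f = v`. -/
def HasStrongMcShaneIntegral (a b : E) (f : E → X) (v : X) : Prop :=
  ∃ F : E × E → X, IsAdditiveIntervalFun (Set.Icc a b) F ∧ F (a, b) = v ∧
    ∀ ε > 0, ∃ δ : E → ℝ, IsGauge (Set.Icc a b) δ ∧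
      ∀ P : Finset (E × E × E), IsMPartition (Set.Icc a b) P → IsFine δ P →
        ∑ x ∈ P, ‖(volume (itemBox x)).toReal • f x.1 - F (x.2.1, x.2.2)‖ < ε

/-- `f` is strongly Henstock–Kurzweil integrable on `[a,b]` with `(HK)∫_{[a,b]} f = v`. -/
def HasStrongHKIntegral (a b : E) (f : E → X) (v : X) : Prop :=
  ∃ F : E × E → X, IsAdditiveIntervalFun (Set.Icc a b) F ∧ F (a, b) = v ∧
    ∀ ε > 0, ∃ δ : E → ℝ, IsGauge (Set.Icc a b) δ ∧
      ∀ P : Finset (E × E × E), IsHKPartition (Set.Icc a b) P → IsFine δ P →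
        ∑ x ∈ P, ‖(volume (itemBox x)).toReal • f x.1 - F (x.2.1, x.2.2)‖ < ε

/-- Property `𝓢*𝓜` on `[a,b]`. -/
def PropSM (a b : E) (f : E → X) : Prop :=
  ∀ ε > 0, ∃ δ : E → ℝ, IsGauge (Set.Icc a b) δ ∧
    ∀ P Q : Finset (E × E × E),
      IsMPartition (Set.Icc a b) P → IsFine δ P →
      IsMPartition (Set.Icc a b) Q → IsFine δ Q →
      ∑ x ∈ P, ∑ y ∈ Q, ‖f x.1 - f y.1‖ * (volume (itemBox x ∩ itemBox y)).toReal < ε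

/-- Property `𝓢*𝓗𝓚` on `[a,b]`. -/
def PropSHK (a b : E) (f : E → X) : Prop :=
  ∀ ε > 0, ∃ δ : E → ℝ, IsGauge (Set.Icc a b) δ ∧
    ∀ P Q : Finset (E × E × E),
      IsHKPartition (Set.Icc a b) P → IsFine δ P →
      IsHKPartition (Set.Icc a b) Q → IsFine δ Q →
      ∑ x ∈ P, ∑ y ∈ Q, ‖f x.1 - f y.1‖ * (volume (itemBox x ∩ itemBox y)).toReal < ε

open scoped ENNReal NNReal Topology

section Bochner

variable {α Y : Type*} [MeasurableSpace α] [NormedAddCommGroup Y]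

/-- A strongly measurable integrable function is, near each point `t`, within `ε + w` of its value
at `t`, where the error density `w` has small integral. -/
lemma exists_local_error_density [TopologicalSpace α] [BorelSpace α] {μ : Measure α}
    [IsFiniteMeasure μ] [μ.WeaklyRegular] {f : α → Y} (hf : StronglyMeasurable f)
    (hfi : Integrable f μ) {ε : ℝ≥0∞} (hε : ε ≠ 0) :
    ∃ w : α → ℝ≥0∞, Measurable w ∧ ∫⁻ s, w s ∂μ ≤ ε ∧
      ∀ t, ∀ᶠ s in 𝓝 t, ‖f t - f s‖ₑ ≤ ε + w s := by
  rcases isEmpty_or_nonempty α with hα | hα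
  · exact ⟨0, measurable_zero, by simp, fun t => hα.elim t⟩
  have hε3 : ε / 3 ≠ 0 := by simp [hε]
  obtain ⟨c, hc, hfc⟩ := hf.isSeparable_range
  have hcne : c.Nonempty := closure_nonempty_iff.1 ((range_nonempty f).mono hfc)
  obtain ⟨d, rfl⟩ := hc.exists_eq_range hcne
  have hd : ∀ t, ∃ n, ‖f t - d n‖ₑ < ε / 3 := fun t => by
    obtain ⟨_, ⟨n, rfl⟩, hn⟩ := EMetric.mem_closure_iff.1 (hfc ⟨t, rfl⟩) (ε / 3)
      (pos_iff_ne_zero.2 hε3)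
    exact ⟨n, by rwa [edist_eq_enorm_sub] at hn⟩
  obtain ⟨η, hη, hηsum⟩ := ENNReal.exists_pos_sum_of_countable' hε ℕ
  have hφm : ∀ n, Measurable fun s => ‖d n - f s‖₊ := fun n =>
    (stronglyMeasurable_const.sub hf).nnnorm.measurable
  have hφ : ∀ n, ∫⁻ s, (‖d n - f s‖₊ : ℝ≥0∞) ∂μ ≠ ∞ := fun n =>
    ((integrable_const (d n)).sub hfi).hasFiniteIntegral.ne
  choose u huφ husc hu using fun n =>
    exists_upperSemicontinuous_le_lintegral_le (μ := μ) _ (hφ n) (hη n).ne'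
  have hum : ∀ n, Measurable (u n) := fun n => (husc n).measurable
  have hmeas : ∀ n, Measurable fun s => (‖d n - f s‖₊ : ℝ≥0∞) - u n s := fun n =>
    (hφm n).coe_nnreal_ennreal.sub (hum n).coe_nnreal_ennreal
  refine ⟨fun s => ∑' n, ((‖d n - f s‖₊ : ℝ≥0∞) - u n s), Measurable.tsum hmeas,
    ?_, fun t => ?_⟩
  · rw [lintegral_tsum fun n => (hmeas n).aemeasurable]
    refine (ENNReal.tsum_le_tsum fun n => ?_).trans hηsum.le
    rw [lintegral_sub (hum n).coe_nnreal_ennreal]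
    · exact tsub_le_iff_left.2 (hu n)
    · exact ne_top_of_le_ne_top (hφ n)
        (lintegral_mono fun s => ENNReal.coe_le_coe.2 (huφ n s))
    · exact Filter.Eventually.of_forall fun s => ENNReal.coe_le_coe.2 (huφ n s)
  · obtain ⟨n, hn⟩ := hd t
    have hut : (u n t : ℝ≥0∞) < ε / 3 :=
      (ENNReal.coe_le_coe.2 (huφ n t)).trans_lt (by
        rw [← enorm_eq_nnnorm, ← enorm_neg, neg_sub]; exact hn)
    have husc' : UpperSemicontinuous fun s => (u n s : ℝ≥0∞) :=
      ENNReal.continuous_coe.comp_upperSemicontinuous (husc n) ENNReal.coe_mono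
    filter_upwards [husc' t _ hut] with s hs
    calc ‖f t - f s‖ₑ = ‖(f t - d n) + (d n - f s)‖ₑ := by rw [sub_add_sub_cancel]
      _ ≤ ‖f t - d n‖ₑ + ‖d n - f s‖ₑ := enorm_add_le _ _
      _ ≤ ε / 3 + (ε / 3 + ((‖d n - f s‖₊ : ℝ≥0∞) - u n s)) := by
          gcongr
          exact (enorm_eq_nnnorm _).le.trans (le_add_tsub.trans (by gcongr))
      _ ≤ ε + ∑' n, ((‖d n - f s‖₊ : ℝ≥0∞) - u n s) := by
          rw [← add_assoc]
          gcongr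
          · calc ε / 3 + ε / 3 ≤ ε / 3 + ε / 3 + ε / 3 := le_self_add
              _ = ε := ENNReal.add_thirds ε
          · exact ENNReal.le_tsum n

/-- A function vanishing almost everywhere is dominated, near each point `t`, at that point `t`,
by a density with small integral. -/
lemma exists_local_density_of_ae_zero [TopologicalSpace α] [OpensMeasurableSpace α]
    {μ : Measure α} [μ.OuterRegular] {h : α → Y} (hh : ∀ᵐ t ∂μ, h t = 0)
    {ε : ℝ≥0∞} (hε : ε ≠ 0) :
    ∃ w : α → ℝ≥0∞, Measurable w ∧ ∫⁻ s, w s ∂μ ≤ ε ∧ ∀ t, ∀ᶠ s in 𝓝 t, ‖h t‖ₑ ≤ w s := by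
  obtain ⟨η, hη, hηsum⟩ := ENNReal.exists_pos_sum_of_countable' hε ℕ
  have hN : μ {t | h t ≠ 0} = 0 := hh
  have hU : ∀ m : ℕ, ∃ U ⊇ {t | h t ≠ 0}, IsOpen U ∧ μ U ≤ η m / m := fun m => by
    obtain ⟨U, hU, hUo, hUμ⟩ := Set.exists_isOpen_le_add {t | h t ≠ 0} μ
      (ε := η m / m) (by simp [(hη m).ne'])
    exact ⟨U, hU, hUo, by simpa [hN] using hUμ⟩
  choose U hNU hUo hUμ using hU
  have hmeas : ∀ m : ℕ, Measurable ((U m).indicator fun _ => (m : ℝ≥0∞)) := fun m =>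
    measurable_const.indicator (hUo m).measurableSet
  refine ⟨fun s => ∑' m : ℕ, (U m).indicator (fun _ => (m : ℝ≥0∞)) s,
    Measurable.tsum hmeas, ?_, fun t => ?_⟩
  · rw [lintegral_tsum fun m => (hmeas m).aemeasurable]
    refine (ENNReal.tsum_le_tsum fun m => ?_).trans hηsum.le
    rw [lintegral_indicator_const (hUo m).measurableSet]
    exact (mul_le_mul_right (hUμ m) _).trans ENNReal.mul_div_le
  · by_cases ht : h t = 0
    · simp [ht]
    obtain ⟨m, hm⟩ := ENNReal.exists_nat_gt (enorm_ne_top (x := h t))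
    filter_upwards [(hUo m).mem_nhds (hNU m ht)] with s hs
    refine hm.le.trans (le_trans ?_ (ENNReal.le_tsum m))
    simp [hs]

/-- An integrable function is, near each point `t`, within `ε + w` of a measurable version of
itself, uniformly in `t`, where the error density `w` has small integral. -/
lemma MeasureTheory.Integrable.exists_local_error_density [TopologicalSpace α] [BorelSpace α]
    {μ : Measure α} [IsFiniteMeasure μ] [μ.WeaklyRegular] {f : α → Y} (hf : Integrable f μ)
    {ε : ℝ≥0∞} (hε : ε ≠ 0) :
    ∃ w : α → ℝ≥0∞, Measurable w ∧ ∫⁻ s, w s ∂μ ≤ ε ∧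
      ∀ t, ∀ᶠ s in 𝓝 t, ‖f t - hf.1.mk f s‖ₑ ≤ ε + w s := by
  have hε2 : ε / 2 ≠ 0 := by simp [hε]
  obtain ⟨w, hw, hwi, hwt⟩ := _root_.exists_local_error_density hf.1.stronglyMeasurable_mk
    (hf.congr hf.1.ae_eq_mk) hε2
  obtain ⟨w', hw', hwi', hwt'⟩ := exists_local_density_of_ae_zero (μ := μ)
    (h := fun t => f t - hf.1.mk f t) (hf.1.ae_eq_mk.mono fun t ht => sub_eq_zero.2 ht) hε2
  refine ⟨fun s => w' s + w s, hw'.add hw, ?_, fun t => ?_⟩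
  · rw [lintegral_add_left hw']
    exact (add_le_add hwi' hwi).trans (ENNReal.add_halves ε).le
  · filter_upwards [hwt t, hwt' t] with s hs hs'
    calc ‖f t - hf.1.mk f s‖ₑ
        = ‖(f t - hf.1.mk f t) + (hf.1.mk f t - hf.1.mk f s)‖ₑ := by rw [sub_add_sub_cancel]
      _ ≤ w' s + (ε / 2 + w s) := (enorm_add_le _ _).trans (add_le_add hs' hs)
      _ ≤ ε + (w' s + w s) := by
          rw [add_left_comm]
          gcongr
          exact ENNReal.half_le_self

end Bochner

lemma aedisjoint_Icc_of_interior_inter_eq_empty {p q r s : ℝ}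
    (h : interior (Icc p q) ∩ interior (Icc r s) = ∅) :
    AEDisjoint volume (Icc p q) (Icc r s) := by
  rw [interior_Icc, interior_Icc] at h
  exact (disjoint_iff_inter_eq_empty.2 h).aedisjoint.congr Ioo_ae_eq_Icc.symm Ioo_ae_eq_Icc.symm

lemma IsMPartition.aedisjoint {K : Set ℝ} {P : Finset (ℝ × ℝ × ℝ)} (hP : IsMPartition K P) :
    (P : Set (ℝ × ℝ × ℝ)).Pairwise (Function.onFun (AEDisjoint volume) itemBox) :=
  fun x hx y hy hxy =>
    aedisjoint_Icc_of_interior_inter_eq_empty (hP.2.1 x hx y hy hxy)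

/-- A Bochner integrable function on a compact interval is strongly McShane integrable, with the
same integral. -/
theorem MeasureTheory.IntegrableOn.hasStrongMcShaneIntegral [CompleteSpace X] {a b : ℝ} {f : ℝ → X}
    (hf : IntegrableOn f (Icc a b)) :
    HasStrongMcShaneIntegral a b f (∫ s in Icc a b, f s) := by
  refine ⟨fun I => ∫ s in Icc I.1 I.2, f s, ?_, rfl, fun ε hε => ?_⟩
  · intro p q r s u w hpq hrs huw hdisj hunion
    simp only
    rw [← hunion]
    exact setIntegral_union₀ (aedisjoint_Icc_of_interior_inter_eq_empty hdisj)
      measurableSet_Icc.nullMeasurableSet (hf.mono_set hpq.1) (hf.mono_set hrs.1)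
  obtain ⟨η, hη, hηε⟩ : ∃ η : ℝ≥0∞, η ≠ 0 ∧ η * volume (Icc a b) + η < ENNReal.ofReal ε := by
    have hlim : Filter.Tendsto (fun η : ℝ≥0∞ => η * volume (Icc a b) + η) (𝓝[>] 0) (𝓝 0) := by
      have h0 : Filter.Tendsto (fun η : ℝ≥0∞ => η * volume (Icc a b) + η) (𝓝 0)
          (𝓝 (0 * volume (Icc a b) + 0)) :=
        (ENNReal.Tendsto.mul_const Filter.tendsto_id
          (Or.inr measure_Icc_lt_top.ne)).add Filter.tendsto_id
      rw [zero_mul, zero_add] at h0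
      exact h0.mono_left nhdsWithin_le_nhds
    obtain ⟨η, hη, hη0⟩ := ((hlim.eventually (gt_mem_nhds (ENNReal.ofReal_pos.2 hε))).and
      self_mem_nhdsWithin).exists
    exact ⟨η, ne_of_gt hη0, hη⟩
  obtain ⟨w, hw, hwi, hwt⟩ := hf.exists_local_error_density hη
  choose δ hδ hδw using fun t => Metric.eventually_nhds_iff_ball.1 (hwt t)
  refine ⟨δ, fun t _ => hδ t, fun P hP hfine => ?_⟩
  rw [← ENNReal.ofReal_lt_ofReal_iff hε]
  refine lt_of_le_of_lt ?_ hηε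
  rw [ENNReal.ofReal_sum_of_nonneg fun _ _ => norm_nonneg _]
  have hfm := hf.1.ae_eq_mk
  calc ∑ x ∈ P, ENNReal.ofReal ‖(volume (itemBox x)).toReal • f x.1 - ∫ s in itemBox x, f s‖
      ≤ ∑ x ∈ P, ∫⁻ s in itemBox x, (η + w s) := Finset.sum_le_sum fun x hx => by
        have hsub : itemBox x ⊆ Icc a b := (hP.1 x hx).2.1
        have hconst : ∫ _ in itemBox x, f x.1 = (volume (itemBox x)).toReal • f x.1 := by
          rw [setIntegral_const]; rfl
        have hci : Integrable (fun _ => f x.1) (volume.restrict (itemBox x)) :=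
          integrableOn_const (by exact measure_Icc_lt_top.ne)
        have hfi : Integrable f (volume.restrict (itemBox x)) := hf.mono_set hsub
        rw [ofReal_norm, ← hconst, ← integral_sub hci hfi]
        refine (enorm_integral_le_lintegral_enorm _).trans (lintegral_mono_ae ?_)
        filter_upwards [ae_restrict_of_ae_restrict_of_subset hsub hfm,
          ae_restrict_mem (by exact measurableSet_Icc : MeasurableSet (itemBox x))] with s hs hsx
        rw [hs]
        exact hδw _ s (hfine x hx hsx)
    _ = ∫⁻ s in Icc a b, (η + w s) := by
        rw [← lintegral_biUnion_finset₀ hP.aedisjoint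
          (fun x _ => by exact measurableSet_Icc.nullMeasurableSet), hP.2.2]
    _ ≤ η * volume (Icc a b) + η := by
        rw [lintegral_add_left measurable_const, setLIntegral_const]
        gcongr

lemma HasStrongMcShaneIntegral.add {a b : ℝ} {f g : ℝ → X} {u v : X}
    (hf : HasStrongMcShaneIntegral a b f u) (hg : HasStrongMcShaneIntegral a b g v) :
    HasStrongMcShaneIntegral a b (fun t => f t + g t) (u + v) := by
  obtain ⟨F, hF, rfl, hFε⟩ := hf
  obtain ⟨G, hG, rfl, hGε⟩ := hg
  refine ⟨fun I => F I + G I, fun p q r s u w h₁ h₂ h₃ h₄ h₅ => ?_, rfl, fun ε hε => ?_⟩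
  · simp only [hF p q r s u w h₁ h₂ h₃ h₄ h₅, hG p q r s u w h₁ h₂ h₃ h₄ h₅]
    abel
  obtain ⟨δ, hδ, hδF⟩ := hFε (ε / 2) (half_pos hε)
  obtain ⟨δ', hδ', hδG⟩ := hGε (ε / 2) (half_pos hε)
  refine ⟨fun t => min (δ t) (δ' t), fun t ht => lt_min (hδ t ht) (hδ' t ht),
    fun P hP hfine => ?_⟩
  calc _ ≤ ∑ x ∈ P, (‖(volume (itemBox x)).toReal • f x.1 - F (x.2.1, x.2.2)‖
        + ‖(volume (itemBox x)).toReal • g x.1 - G (x.2.1, x.2.2)‖) :=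
        Finset.sum_le_sum fun x _ => by
          rw [smul_add, add_sub_add_comm]
          exact norm_add_le _ _
    _ < ε / 2 + ε / 2 := by
        rw [Finset.sum_add_distrib]
        exact add_lt_add
          (hδF P hP fun x hx => (hfine x hx).trans (Metric.ball_subset_ball (min_le_left _ _)))
          (hδG P hP fun x hx => (hfine x hx).trans (Metric.ball_subset_ball (min_le_right _ _)))
    _ = ε := add_halves ε

/-- Changing a function on a null set affects neither strong McShane integrability nor the
integral. -/
lemma HasStrongMcShaneIntegral.congr_ae [CompleteSpace X] {a b : ℝ} {f g : ℝ → X} {u : X}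
    (hf : HasStrongMcShaneIntegral a b f u) (hfg : f =ᵐ[volume.restrict (Icc a b)] g) :
    HasStrongMcShaneIntegral a b g u := by
  have h0 : (fun t => g t - f t) =ᵐ[volume.restrict (Icc a b)] 0 :=
    hfg.mono fun t ht => sub_eq_zero.2 ht.symm
  have hi : IntegrableOn (fun t => g t - f t) (Icc a b) :=
    (integrable_zero ℝ X _).congr h0.symm
  simpa [integral_congr_ae h0] using hf.add hi.hasStrongMcShaneIntegral

section Dyadic

/-- The `i`-th point of the subdivision of `[a, b]` into `2 ^ N` equal intervals. -/
noncomputable def dyadicPoint (a b : ℝ) (N i : ℕ) : ℝ := a + (b - a) * (i / 2 ^ N)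

/-- The index of the interval of the `N`-th dyadic subdivision of `[a, b)` containing `x`. -/
noncomputable def dyadicIndex (a b : ℝ) (N : ℕ) (x : ℝ) : ℕ := ⌊(x - a) / (b - a) * 2 ^ N⌋₊

variable {a b : ℝ} {N i k : ℕ} {x : ℝ}

lemma dyadicPoint_strictMono (hab : a < b) : StrictMono (dyadicPoint a b N) := fun i j hij => by
  have : (0 : ℝ) < b - a := sub_pos.2 hab
  unfold dyadicPoint
  gcongr

@[simp] lemma dyadicPoint_zero : dyadicPoint a b N 0 = a := by simp [dyadicPoint]

@[simp] lemma dyadicPoint_two_pow : dyadicPoint a b N (2 ^ N) = b := by simp [dyadicPoint]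

lemma le_dyadicPoint (hab : a < b) : a ≤ dyadicPoint a b N i :=
  dyadicPoint_zero.symm.le.trans ((dyadicPoint_strictMono hab).monotone i.zero_le)

lemma dyadicPoint_le (hab : a < b) (hi : i ≤ 2 ^ N) : dyadicPoint a b N i ≤ b :=
  ((dyadicPoint_strictMono hab).monotone hi).trans dyadicPoint_two_pow.le

lemma dyadicPoint_succ_sub : dyadicPoint a b N (i + 1) - dyadicPoint a b N i = (b - a) / 2 ^ N := by
  simp only [dyadicPoint]
  push_cast
  ring

lemma dyadicIndex_eq_iff (hab : a < b) (hx : a ≤ x) :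
    dyadicIndex a b N x = i ↔ x ∈ Ico (dyadicPoint a b N i) (dyadicPoint a b N (i + 1)) := by
  have h0 : (0 : ℝ) < b - a := sub_pos.2 hab
  have hxa : 0 ≤ x - a := sub_nonneg.2 hx
  have h2 : (0 : ℝ) < 2 ^ N := by positivity
  rw [dyadicIndex, Nat.floor_eq_iff (by positivity), mem_Ico, dyadicPoint, dyadicPoint,
    ← le_sub_iff_add_le', ← sub_lt_iff_lt_add' (b := a), ← le_div_iff₀' h0, ← div_lt_iff₀' h0,
    div_le_iff₀ h2, lt_div_iff₀ h2]
  push_cast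
  rfl

lemma mem_Ico_dyadicIndex (hab : a < b) (hx : a ≤ x) :
    x ∈ Ico (dyadicPoint a b N (dyadicIndex a b N x))
      (dyadicPoint a b N (dyadicIndex a b N x + 1)) :=
  (dyadicIndex_eq_iff hab hx).1 rfl

lemma dyadicIndex_lt (hab : a < b) (hx : x ∈ Ico a b) : dyadicIndex a b N x < 2 ^ N := by
  refine (dyadicPoint_strictMono (N := N) hab).lt_iff_lt.1 ?_
  rw [dyadicPoint_two_pow]
  exact (mem_Ico_dyadicIndex hab hx.1).1.trans_lt hx.2

lemma exists_mem_Icc_dyadicPoint (hab : a < b) (N : ℕ) (hx : x ∈ Icc a b) :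
    ∃ i < 2 ^ N, x ∈ Icc (dyadicPoint a b N i) (dyadicPoint a b N (i + 1)) := by
  rcases hx.2.lt_or_eq with h | rfl
  · exact ⟨_, dyadicIndex_lt hab ⟨hx.1, h⟩, Ico_subset_Icc_self (mem_Ico_dyadicIndex hab hx.1)⟩
  · have h1 : 2 ^ N - 1 + 1 = 2 ^ N := Nat.sub_add_cancel Nat.one_le_two_pow
    refine ⟨2 ^ N - 1, by omega, dyadicPoint_le hab (by omega), ?_⟩
    rw [h1, dyadicPoint_two_pow]

lemma dyadicIndex_div_two_pow :
    dyadicIndex a b (N + k) x / 2 ^ k = dyadicIndex a b N x := by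
  have := Nat.floor_div_natCast ((x - a) / (b - a) * 2 ^ (N + k)) (2 ^ k)
  rw [dyadicIndex, ← this, dyadicIndex]
  congr 1
  push_cast
  rw [pow_add, ← mul_assoc, mul_div_cancel_right₀ _ (by positivity)]

lemma dyadicPoint_add_mul : dyadicPoint a b (N + k) (i * 2 ^ k) = dyadicPoint a b N i := by
  simp only [dyadicPoint]
  push_cast
  rw [pow_add, mul_div_mul_right _ _ (by positivity)]

lemma dyadicPoint_div_two_pow_le (hab : a < b) :
    dyadicPoint a b N (i / 2 ^ k) ≤ dyadicPoint a b (N + k) i := by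
  rw [← dyadicPoint_add_mul (k := k)]
  exact (dyadicPoint_strictMono hab).monotone (Nat.div_mul_le_self _ _)

lemma le_dyadicPoint_div_two_pow (hab : a < b) :
    dyadicPoint a b (N + k) (i + 1) ≤ dyadicPoint a b N (i / 2 ^ k + 1) := by
  rw [← dyadicPoint_add_mul (N := N) (k := k)]
  refine (dyadicPoint_strictMono hab).monotone ?_
  rw [mul_comm]
  exact Nat.lt_mul_div_succ _ (by positivity)

lemma measurable_dyadicIndex : Measurable (dyadicIndex a b N) :=
  Nat.measurable_floor.comp (by fun_prop)

end Dyadic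

section Grid

/-- The lower corner of the cell `c` of the `N`-th dyadic grid of `[a, b]`. -/
noncomputable def gridPoint (a b : ℝ × ℝ) (N : ℕ) (c : ℕ × ℕ) : ℝ × ℝ :=
  (dyadicPoint a.1 b.1 N c.1, dyadicPoint a.2 b.2 N c.2)

/-- The closed cell `c` of the `N`-th dyadic grid of `[a, b]`. -/
def gridCell (a b : ℝ × ℝ) (N : ℕ) (c : ℕ × ℕ) : Set (ℝ × ℝ) :=
  Icc (gridPoint a b N c) (gridPoint a b N (c + 1))

/-- The half-open cell `c` of the `N`-th dyadic grid of `[a, b]`. -/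
def gridIco (a b : ℝ × ℝ) (N : ℕ) (c : ℕ × ℕ) : Set (ℝ × ℝ) :=
  Ico (dyadicPoint a.1 b.1 N c.1) (dyadicPoint a.1 b.1 N (c.1 + 1)) ×ˢ
    Ico (dyadicPoint a.2 b.2 N c.2) (dyadicPoint a.2 b.2 N (c.2 + 1))

/-- The cell of the `N`-th dyadic grid containing `x`. -/
noncomputable def gridIndex (a b : ℝ × ℝ) (N : ℕ) (x : ℝ × ℝ) : ℕ × ℕ :=
  (dyadicIndex a.1 b.1 N x.1, dyadicIndex a.2 b.2 N x.2)

/-- The indices of the cells of the `N`-th dyadic grid. -/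
def gridIndices (N : ℕ) : Finset (ℕ × ℕ) := Finset.range (2 ^ N) ×ˢ Finset.range (2 ^ N)

/-- The cell of the `N`-th dyadic grid containing the cell `c` of the `(N + k)`-th one. -/
def gridParent (k : ℕ) (c : ℕ × ℕ) : ℕ × ℕ := (c.1 / 2 ^ k, c.2 / 2 ^ k)

/-- The rectangle `[a₁, b₁) × [a₂, b₂)`. -/
def prodIco (a b : ℝ × ℝ) : Set (ℝ × ℝ) := Ico a.1 b.1 ×ˢ Ico a.2 b.2

/-- The tagging `τ` of the `N`-th dyadic grid of `[a, b]` is `δ`-fine. -/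
def GridFine (a b : ℝ × ℝ) (δ : ℝ × ℝ → ℝ) (N : ℕ) (τ : ℕ × ℕ → ℝ × ℝ) : Prop :=
  ∀ c ∈ gridIndices N, τ c ∈ Icc a b ∧ gridCell a b N c ⊆ Metric.ball (τ c) (δ (τ c))

variable {a b x : ℝ × ℝ} {N k : ℕ} {c : ℕ × ℕ} {δ : ℝ × ℝ → ℝ} {τ : ℕ × ℕ → ℝ × ℝ}

lemma mem_gridIndices : c ∈ gridIndices N ↔ c.1 < 2 ^ N ∧ c.2 < 2 ^ N := by
  simp [gridIndices]

lemma measurable_gridIndex : Measurable (gridIndex a b N) :=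
  (measurable_dyadicIndex.comp measurable_fst).prodMk (measurable_dyadicIndex.comp measurable_snd)

lemma gridParent_gridIndex : gridParent k (gridIndex a b (N + k) x) = gridIndex a b N x := by
  simp [gridParent, gridIndex, dyadicIndex_div_two_pow]

lemma gridParent_mem_gridIndices (hc : c ∈ gridIndices (N + k)) :
    gridParent k c ∈ gridIndices N := by
  rw [mem_gridIndices, pow_add] at hc
  exact mem_gridIndices.2 ⟨Nat.div_lt_of_lt_mul (by rw [mul_comm]; exact hc.1),
    Nat.div_lt_of_lt_mul (by rw [mul_comm]; exact hc.2)⟩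

lemma measurableSet_prodIco : MeasurableSet (prodIco a b) :=
  measurableSet_Ico.prod measurableSet_Ico

lemma measurableSet_gridIco : MeasurableSet (gridIco a b N c) :=
  measurableSet_Ico.prod measurableSet_Ico

lemma prodIco_ae_eq_Icc : (prodIco a b : Set (ℝ × ℝ)) =ᵐ[volume] Icc a b := by
  rw [Icc_prod_eq]
  exact Measure.set_prod_ae_eq Ico_ae_eq_Icc Ico_ae_eq_Icc

lemma volume_gridIco : volume (gridIco a b N c) = volume (gridCell a b N c) :=
  measure_congr (prodIco_ae_eq_Icc (a := gridPoint a b N c) (b := gridPoint a b N (c + 1)))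

lemma volume_gridCell_ne_top : volume (gridCell a b N c) ≠ ∞ := isCompact_Icc.measure_lt_top.ne

lemma interior_Icc_prod {p q : ℝ × ℝ} :
    interior (Icc p q) = Ioo p.1 q.1 ×ˢ Ioo p.2 q.2 := by
  rw [Icc_prod_eq, interior_prod_eq, interior_Icc, interior_Icc]

lemma isSubinterval_Icc_prod {p q : ℝ × ℝ} (hap : a ≤ p) (hqb : q ≤ b) (h₁ : p.1 < q.1)
    (h₂ : p.2 < q.2) : IsSubinterval (Icc a b) p q := by
  refine ⟨Icc_subset_Icc hap hqb, ?_⟩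
  rw [interior_Icc_prod]
  exact (nonempty_Ioo.2 h₁).prod (nonempty_Ioo.2 h₂)

lemma gridCell_subset_gridCell (h₁ : a.1 < b.1) (h₂ : a.2 < b.2) :
    gridCell a b (N + k) c ⊆ gridCell a b N (gridParent k c) :=
  Icc_subset_Icc ⟨dyadicPoint_div_two_pow_le h₁, dyadicPoint_div_two_pow_le h₂⟩
    ⟨le_dyadicPoint_div_two_pow h₁, le_dyadicPoint_div_two_pow h₂⟩

lemma GridFine.refine (h₁ : a.1 < b.1) (h₂ : a.2 < b.2) (hτ : GridFine a b δ N τ) (k : ℕ) :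
    GridFine a b δ (N + k) (τ ∘ gridParent k) := fun _ hc =>
  ⟨(hτ _ (gridParent_mem_gridIndices hc)).1,
    (gridCell_subset_gridCell h₁ h₂).trans (hτ _ (gridParent_mem_gridIndices hc)).2⟩

lemma gridIndex_eq_iff (h₁ : a.1 < b.1) (h₂ : a.2 < b.2) (hx : a ≤ x) :
    gridIndex a b N x = c ↔ x ∈ gridIco a b N c := by
  rw [gridIndex, Prod.ext_iff, dyadicIndex_eq_iff h₁ hx.1, dyadicIndex_eq_iff h₂ hx.2]
  rfl

lemma le_gridPoint (h₁ : a.1 < b.1) (h₂ : a.2 < b.2) : a ≤ gridPoint a b N c :=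
  ⟨le_dyadicPoint h₁, le_dyadicPoint h₂⟩

lemma gridPoint_le (h₁ : a.1 < b.1) (h₂ : a.2 < b.2) (hc₁ : c.1 ≤ 2 ^ N) (hc₂ : c.2 ≤ 2 ^ N) :
    gridPoint a b N c ≤ b :=
  ⟨dyadicPoint_le h₁ hc₁, dyadicPoint_le h₂ hc₂⟩

lemma gridIndex_eq_of_mem_gridIco (h₁ : a.1 < b.1) (h₂ : a.2 < b.2) (hx : x ∈ gridIco a b N c) :
    gridIndex a b N x = c :=
  (gridIndex_eq_iff h₁ h₂ ((le_gridPoint h₁ h₂).trans (c := x) ⟨hx.1.1, hx.2.1⟩)).2 hx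

lemma mem_gridIco_gridIndex (h₁ : a.1 < b.1) (h₂ : a.2 < b.2) (hx : a ≤ x) :
    x ∈ gridIco a b N (gridIndex a b N x) :=
  (gridIndex_eq_iff h₁ h₂ hx).1 rfl

lemma gridIco_subset_gridCell : gridIco a b N c ⊆ gridCell a b N c := fun _ hx =>
  ⟨⟨hx.1.1, hx.2.1⟩, ⟨hx.1.2.le, hx.2.2.le⟩⟩

lemma gridIndex_mem_gridIndices (h₁ : a.1 < b.1) (h₂ : a.2 < b.2) (hx : x ∈ prodIco a b) :
    gridIndex a b N x ∈ gridIndices N :=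
  mem_gridIndices.2 ⟨dyadicIndex_lt h₁ hx.1, dyadicIndex_lt h₂ hx.2⟩

lemma isSubinterval_gridCell (h₁ : a.1 < b.1) (h₂ : a.2 < b.2) (hc : c ∈ gridIndices N) :
    IsSubinterval (Icc a b) (gridPoint a b N c) (gridPoint a b N (c + 1)) := by
  rw [mem_gridIndices] at hc
  exact isSubinterval_Icc_prod (le_gridPoint h₁ h₂) (gridPoint_le h₁ h₂ hc.1 hc.2)
    (dyadicPoint_strictMono h₁ (Nat.lt_succ_self _))
    (dyadicPoint_strictMono h₂ (Nat.lt_succ_self _))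

lemma biUnion_gridIco (h₁ : a.1 < b.1) (h₂ : a.2 < b.2) (N : ℕ) :
    ⋃ c ∈ gridIndices N, gridIco a b N c = prodIco a b := by
  refine Subset.antisymm (iUnion₂_subset fun c hc x hx => ?_) fun x hx =>
    mem_biUnion (gridIndex_mem_gridIndices h₁ h₂ hx)
      (mem_gridIco_gridIndex h₁ h₂ ⟨hx.1.1, hx.2.1⟩)
  rw [mem_gridIndices] at hc
  exact ⟨⟨(le_dyadicPoint h₁).trans hx.1.1, hx.1.2.trans_le (dyadicPoint_le h₁ hc.1)⟩,
    ⟨(le_dyadicPoint h₂).trans hx.2.1, hx.2.2.trans_le (dyadicPoint_le h₂ hc.2)⟩⟩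

lemma pairwiseDisjoint_gridIco (h₁ : a.1 < b.1) (h₂ : a.2 < b.2) (s : Set (ℕ × ℕ)) :
    s.PairwiseDisjoint (gridIco a b N) := fun _ _ _ _ hne =>
  disjoint_left.2 fun _ hx hx' => hne <|
    (gridIndex_eq_of_mem_gridIco h₁ h₂ hx).symm.trans (gridIndex_eq_of_mem_gridIco h₁ h₂ hx')

lemma lintegral_comp_gridIndex (h₁ : a.1 < b.1) (h₂ : a.2 < b.2) (G : ℕ × ℕ → ℝ≥0∞) :
    ∫⁻ x in prodIco a b, G (gridIndex a b N x) =
      ∑ c ∈ gridIndices N, volume (gridCell a b N c) * G c := by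
  rw [← biUnion_gridIco h₁ h₂ N, lintegral_biUnion_finset (pairwiseDisjoint_gridIco h₁ h₂ _)
    fun _ _ => measurableSet_gridIco]
  refine Finset.sum_congr rfl fun c _ => ?_
  rw [setLIntegral_congr_fun (g := fun _ => G c) measurableSet_gridIco fun x hx => by
    simp only [gridIndex_eq_of_mem_gridIco h₁ h₂ hx], setLIntegral_const, volume_gridIco, mul_comm]

lemma stronglyMeasurable_comp_gridIndex {Y : Type*} [TopologicalSpace Y] (G : ℕ × ℕ → Y) :
    StronglyMeasurable fun x => G (gridIndex a b N x) :=
  (StronglyMeasurable.of_discrete (f := G)).comp_measurable measurable_gridIndex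

lemma integrableOn_comp_gridIndex {Y : Type*} [NormedAddCommGroup Y] (h₁ : a.1 < b.1)
    (h₂ : a.2 < b.2) (G : ℕ × ℕ → Y) :
    IntegrableOn (fun x => G (gridIndex a b N x)) (prodIco a b) := by
  refine ⟨(stronglyMeasurable_comp_gridIndex G).aestronglyMeasurable, ?_⟩
  rw [HasFiniteIntegral, lintegral_comp_gridIndex h₁ h₂ fun c => ‖G c‖ₑ]
  exact ENNReal.sum_lt_top.2 fun c _ =>
    ENNReal.mul_lt_top volume_gridCell_ne_top.lt_top enorm_lt_top

lemma setIntegral_comp_gridIndex [CompleteSpace X] (h₁ : a.1 < b.1) (h₂ : a.2 < b.2)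
    (G : ℕ × ℕ → X) :
    ∫ x in prodIco a b, G (gridIndex a b N x) =
      ∑ c ∈ gridIndices N, (volume (gridCell a b N c)).toReal • G c := by
  have hi := integrableOn_comp_gridIndex (N := N) h₁ h₂ G
  rw [← biUnion_gridIco h₁ h₂ N] at hi ⊢
  rw [integral_biUnion_finset _ (fun _ _ => measurableSet_gridIco)
    (pairwiseDisjoint_gridIco h₁ h₂ _)
    fun c hc => hi.mono_set (subset_biUnion_of_mem (u := gridIco a b N) hc)]
  refine Finset.sum_congr rfl fun c _ => ?_
  rw [setIntegral_congr_fun (g := fun _ => G c) measurableSet_gridIco fun x hx => by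
    simp only [gridIndex_eq_of_mem_gridIco h₁ h₂ hx], setIntegral_const, measureReal_def,
    volume_gridIco]

/-- The tagged cells of a dyadic grid form an `𝓜`-partition. -/
lemma isMPartition_grid (h₁ : a.1 < b.1) (h₂ : a.2 < b.2)
    (hτ : ∀ c ∈ gridIndices N, τ c ∈ Icc a b) :
    IsMPartition (Icc a b) ((gridIndices N).image
      fun c => (τ c, gridPoint a b N c, gridPoint a b N (c + 1))) := by
  rw [IsMPartition, Finset.forall_mem_image, Finset.forall_mem_image,
    Finset.set_biUnion_finset_image]
  refine ⟨fun c hc => ⟨hτ c hc, isSubinterval_gridCell h₁ h₂ hc⟩, fun c _ => ?_, ?_⟩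
  · rw [Finset.forall_mem_image]
    intro c' _ hne
    rw [itemBox, itemBox, ← disjoint_iff_inter_eq_empty, interior_Icc_prod, interior_Icc_prod]
    refine (pairwiseDisjoint_gridIco h₁ h₂ univ (mem_univ c) (mem_univ c') ?_).mono
      (prod_mono Ioo_subset_Ico_self Ioo_subset_Ico_self)
      (prod_mono Ioo_subset_Ico_self Ioo_subset_Ico_self)
    rintro rfl
    exact hne rfl
  · refine Subset.antisymm
      (iUnion₂_subset fun c hc => (isSubinterval_gridCell h₁ h₂ hc).1) fun x hx => ?_
    obtain ⟨i, hi, hxi⟩ := exists_mem_Icc_dyadicPoint h₁ N ⟨hx.1.1, hx.2.1⟩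
    obtain ⟨j, hj, hxj⟩ := exists_mem_Icc_dyadicPoint h₂ N ⟨hx.1.2, hx.2.2⟩
    exact mem_biUnion (x := (i, j)) (mem_gridIndices.2 ⟨hi, hj⟩)
      ⟨⟨hxi.1, hxj.1⟩, ⟨hxi.2, hxj.2⟩⟩

lemma eventually_gridCell_subset_ball {r : ℝ} (hr : 0 < r) :
    ∀ᶠ N in Filter.atTop, ∀ c, ∀ x ∈ gridCell a b N c, gridCell a b N c ⊆ Metric.ball x r := by
  have hlim : ∀ l : ℝ, ∀ᶠ N : ℕ in Filter.atTop, l / 2 ^ N < r := fun l => by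
    have := (tendsto_pow_atTop_nhds_zero_of_lt_one (r := (1 / 2 : ℝ)) (by norm_num)
      (by norm_num)).const_mul l
    rw [mul_zero] at this
    filter_upwards [this.eventually (gt_mem_nhds hr)] with N hN
    rwa [one_div, inv_pow, ← div_eq_mul_inv] at hN
  filter_upwards [hlim (b.1 - a.1), hlim (b.2 - a.2)] with N hN₁ hN₂ c x hx y hy
  rw [Metric.mem_ball, Prod.dist_eq, max_lt_iff]
  exact ⟨(Real.dist_le_of_mem_Icc ⟨hy.1.1, hy.2.1⟩ ⟨hx.1.1, hx.2.1⟩).trans_lt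
      (dyadicPoint_succ_sub.trans_lt hN₁),
    (Real.dist_le_of_mem_Icc ⟨hy.1.2, hy.2.2⟩ ⟨hx.1.2, hx.2.2⟩).trans_lt
      (dyadicPoint_succ_sub.trans_lt hN₂)⟩

lemma IsGauge.exists_gridFine (h₁ : a.1 < b.1) (h₂ : a.2 < b.2) (hδ : IsGauge (Icc a b) δ) :
    ∃ N τ, GridFine a b δ N τ := by
  obtain ⟨r, hr, hball⟩ := lebesgue_number_lemma_of_metric (s := Icc a b)
    (c := fun t : Icc a b => Metric.ball (t : ℝ × ℝ) (δ t)) isCompact_Icc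
    (fun _ => Metric.isOpen_ball)
    fun t ht => mem_iUnion.2 ⟨⟨t, ht⟩, Metric.mem_ball_self (hδ t ht)⟩
  obtain ⟨N, hN⟩ := (eventually_gridCell_subset_ball hr).exists
  have hex : ∀ c, ∃ t, c ∈ gridIndices N → t ∈ Icc a b ∧
      gridCell a b N c ⊆ Metric.ball t (δ t) := fun c => by
    by_cases hc : c ∈ gridIndices N
    · have hs := isSubinterval_gridCell h₁ h₂ hc
      have hmem : gridPoint a b N c ∈ gridCell a b N c :=
        left_mem_Icc.2 (nonempty_Icc.1 (hs.2.mono interior_subset))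
      obtain ⟨t, ht⟩ := hball _ (hs.1 hmem)
      exact ⟨t, fun _ => ⟨t.2, (hN c _ hmem).trans ht⟩⟩
    · exact ⟨0, fun h => absurd h hc⟩
  choose τ hτ using hex
  exact ⟨N, τ, hτ⟩

end Grid

section Additive

variable {Y : Type*} [NormedAddCommGroup Y] {a b : ℝ × ℝ} {F : (ℝ × ℝ) × ℝ × ℝ → Y}

lemma IsAdditiveIntervalFun.sum_fst (hF : IsAdditiveIntervalFun (Icc a b) F) {x : ℕ → ℝ}
    (hx : StrictMono x) {y y' : ℝ} (hy : y < y') (ha : a ≤ (x 0, y)) (n : ℕ)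
    (hb : (x (n + 1), y') ≤ b) :
    F ((x 0, y), (x (n + 1), y')) = ∑ i ∈ Finset.range (n + 1), F ((x i, y), (x (i + 1), y')) := by
  induction n with
  | zero => simp
  | succ n ih =>
    have h0 : x 0 < x (n + 1) := hx (by omega)
    have h1 : x (n + 1) < x (n + 1 + 1) := hx (by omega)
    have hb' : (x (n + 1), y') ≤ b := ⟨h1.le.trans hb.1, hb.2⟩
    rw [Finset.sum_range_succ, ← ih hb']
    refine hF _ _ _ _ _ _ (isSubinterval_Icc_prod ha hb' h0 hy)
      (isSubinterval_Icc_prod ⟨ha.1.trans h0.le, ha.2⟩ hb h1 hy)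
      (isSubinterval_Icc_prod ha hb (h0.trans h1) hy) ?_ ?_
    · rw [interior_Icc_prod, interior_Icc_prod, ← disjoint_iff_inter_eq_empty]
      exact Disjoint.set_prod_left (by
        rw [Ioo_disjoint_Ioo]
        exact (min_le_left _ _).trans (le_max_right _ _)) _ _
    · rw [Icc_prod_eq, Icc_prod_eq, Icc_prod_eq, ← union_prod, Icc_union_Icc_eq_Icc h0.le h1.le]

lemma IsAdditiveIntervalFun.sum_snd (hF : IsAdditiveIntervalFun (Icc a b) F) {y : ℕ → ℝ}
    (hy : StrictMono y) {x x' : ℝ} (hx : x < x') (ha : a ≤ (x, y 0)) (n : ℕ)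
    (hb : (x', y (n + 1)) ≤ b) :
    F ((x, y 0), (x', y (n + 1))) = ∑ i ∈ Finset.range (n + 1), F ((x, y i), (x', y (i + 1))) := by
  induction n with
  | zero => simp
  | succ n ih =>
    have h0 : y 0 < y (n + 1) := hy (by omega)
    have h1 : y (n + 1) < y (n + 1 + 1) := hy (by omega)
    have hb' : (x', y (n + 1)) ≤ b := ⟨hb.1, h1.le.trans hb.2⟩
    rw [Finset.sum_range_succ, ← ih hb']
    refine hF _ _ _ _ _ _ (isSubinterval_Icc_prod ha hb' hx h0)
      (isSubinterval_Icc_prod ⟨ha.1, ha.2.trans h0.le⟩ hb hx h1)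
      (isSubinterval_Icc_prod ha hb hx (h0.trans h1)) ?_ ?_
    · rw [interior_Icc_prod, interior_Icc_prod, ← disjoint_iff_inter_eq_empty]
      exact Disjoint.set_prod_right (by
        rw [Ioo_disjoint_Ioo]
        exact (min_le_left _ _).trans (le_max_right _ _)) _ _
    · rw [Icc_prod_eq, Icc_prod_eq, Icc_prod_eq, ← prod_union, Icc_union_Icc_eq_Icc h0.le h1.le]

lemma IsAdditiveIntervalFun.sum_grid (h₁ : a.1 < b.1) (h₂ : a.2 < b.2)
    (hF : IsAdditiveIntervalFun (Icc a b) F) (N : ℕ) :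
    F (a, b) = ∑ c ∈ gridIndices N, F (gridPoint a b N c, gridPoint a b N (c + 1)) := by
  have hN : 2 ^ N - 1 + 1 = 2 ^ N := Nat.sub_add_cancel Nat.one_le_two_pow
  have hx := hF.sum_fst (dyadicPoint_strictMono (N := N) h₁) h₂ (y := a.2) (y' := b.2)
    (by rw [dyadicPoint_zero]) (2 ^ N - 1) (by rw [hN, dyadicPoint_two_pow])
  simp only [hN, dyadicPoint_zero, dyadicPoint_two_pow] at hx
  rw [gridIndices, Finset.sum_product]
  refine hx.trans (Finset.sum_congr rfl fun i hi => ?_)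
  have hy := hF.sum_snd (dyadicPoint_strictMono (N := N) h₂)
    (dyadicPoint_strictMono (N := N) h₁ (Nat.lt_succ_self i))
    (by rw [dyadicPoint_zero]; exact ⟨le_dyadicPoint h₁, le_rfl⟩) (2 ^ N - 1)
    (by
      rw [hN, dyadicPoint_two_pow]
      exact ⟨dyadicPoint_le h₁ (Finset.mem_range.1 hi), le_rfl⟩)
  simp only [hN, dyadicPoint_zero, dyadicPoint_two_pow] at hy
  exact hy

end Additive

section McShaneToBochner

variable {a b : ℝ × ℝ} {f : ℝ × ℝ → X} {F : (ℝ × ℝ) × ℝ × ℝ → X} {δ δ' : ℝ × ℝ → ℝ} {ε ε' : ℝ}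
  {N M : ℕ} {τ σ : ℕ × ℕ → ℝ × ℝ}

/-- `δ` realizes the accuracy `ε` in the definition of strong McShane integrability of `f` on
`[a, b]` with primitive `F`. -/
def IsStrongGauge (a b : ℝ × ℝ) (f : ℝ × ℝ → X) (F : (ℝ × ℝ) × ℝ × ℝ → X) (δ : ℝ × ℝ → ℝ)
    (ε : ℝ) : Prop :=
  ∀ P, IsMPartition (Icc a b) P → IsFine δ P →
    ∑ x ∈ P, ‖(volume (itemBox x)).toReal • f x.1 - F (x.2.1, x.2.2)‖ < ε

lemma IsStrongGauge.sum_grid_lt (h₁ : a.1 < b.1) (h₂ : a.2 < b.2) (hδ : IsStrongGauge a b f F δ ε)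
    (hτ : GridFine a b δ N τ) :
    ∑ c ∈ gridIndices N, ‖(volume (gridCell a b N c)).toReal • f (τ c) -
      F (gridPoint a b N c, gridPoint a b N (c + 1))‖ < ε := by
  have := hδ _ (isMPartition_grid h₁ h₂ fun c hc => (hτ c hc).1)
    (Finset.forall_mem_image.2 fun c hc => (hτ c hc).2)
  rwa [Finset.sum_image fun c _ c' _ h => ?_] at this
  have hp : gridPoint a b N c = gridPoint a b N c' := (Prod.ext_iff.1 (Prod.ext_iff.1 h).2).1
  exact Prod.ext ((dyadicPoint_strictMono h₁).injective (Prod.ext_iff.1 hp).1)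
    ((dyadicPoint_strictMono h₂).injective (Prod.ext_iff.1 hp).2)

/-- The step functions of two fine taggings of the same grid are close in `L¹`. -/
lemma IsStrongGauge.lintegral_enorm_sub_le (h₁ : a.1 < b.1) (h₂ : a.2 < b.2)
    (hδ : IsStrongGauge a b f F δ ε) (hδ' : IsStrongGauge a b f F δ' ε')
    (hτ : GridFine a b δ N τ) (hσ : GridFine a b δ' N σ) :
    ∫⁻ x in prodIco a b, ‖f (τ (gridIndex a b N x)) - f (σ (gridIndex a b N x))‖ₑ ≤
      ENNReal.ofReal (ε + ε') := by
  rw [lintegral_comp_gridIndex h₁ h₂ fun c => ‖f (τ c) - f (σ c)‖ₑ]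
  calc _ = ENNReal.ofReal (∑ c ∈ gridIndices N, (volume (gridCell a b N c)).toReal *
        ‖f (τ c) - f (σ c)‖) := by
        rw [ENNReal.ofReal_sum_of_nonneg fun _ _ => by positivity]
        refine Finset.sum_congr rfl fun c _ => ?_
        rw [ENNReal.ofReal_mul ENNReal.toReal_nonneg,
          ENNReal.ofReal_toReal volume_gridCell_ne_top, ofReal_norm]
    _ ≤ _ := by
        refine ENNReal.ofReal_le_ofReal (le_trans ?_
          (add_lt_add (hδ.sum_grid_lt h₁ h₂ hτ) (hδ'.sum_grid_lt h₁ h₂ hσ)).le)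
        rw [← Finset.sum_add_distrib]
        refine Finset.sum_le_sum fun c _ => ?_
        rw [← abs_of_nonneg (ENNReal.toReal_nonneg (a := volume (gridCell a b N c))),
          ← Real.norm_eq_abs, ← norm_smul, smul_sub, Real.norm_eq_abs,
          abs_of_nonneg ENNReal.toReal_nonneg]
        exact norm_sub_le_norm_sub_add_norm_sub _ _ _ |>.trans_eq (by rw [norm_sub_rev (F _)])

/-- The step functions of fine taggings of any two grids are close in `L¹`. -/
lemma IsStrongGauge.lintegral_enorm_sub_le' (h₁ : a.1 < b.1) (h₂ : a.2 < b.2)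
    (hδ : IsStrongGauge a b f F δ ε) (hδ' : IsStrongGauge a b f F δ' ε')
    (hτ : GridFine a b δ N τ) (hσ : GridFine a b δ' M σ) :
    ∫⁻ x in prodIco a b, ‖f (τ (gridIndex a b N x)) - f (σ (gridIndex a b M x))‖ₑ ≤
      ENNReal.ofReal (ε + ε') := by
  have hσ' := hσ.refine h₁ h₂ N
  rw [add_comm] at hσ'
  convert hδ.lintegral_enorm_sub_le h₁ h₂ hδ' (hτ.refine h₁ h₂ M) hσ' using 4 with x
  simp only [Function.comp_apply, gridParent_gridIndex]
  rw [add_comm N M, gridParent_gridIndex]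

open Classical in
/-- The step function of a fine tagging is close to `f` in measure. -/
lemma IsStrongGauge.mul_measure_le (h₁ : a.1 < b.1) (h₂ : a.2 < b.2) (hg : IsGauge (Icc a b) δ)
    (hδ : IsStrongGauge a b f F δ ε) (hτ : GridFine a b δ N τ) (η : ℝ≥0∞) :
    η * volume.restrict (prodIco a b) {x | η ≤ edist (f (τ (gridIndex a b N x))) (f x)} ≤
      ENNReal.ofReal (ε + ε) := by
  set μ := volume.restrict (prodIco a b) with hμ
  have hIcc : prodIco a b ⊆ Icc a b := fun x hx => ⟨⟨hx.1.1, hx.2.1⟩, ⟨hx.1.2.le, hx.2.2.le⟩⟩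
  set S : Set (ℝ × ℝ) := {x ∈ prodIco a b | η ≤ edist (f (τ (gridIndex a b N x))) (f x)}
  let good (k : ℕ) (c : ℕ × ℕ) : Prop := ∃ t ∈ S, gridParent k c = gridIndex a b N t ∧
    gridCell a b (N + k) c ⊆ Metric.ball t (δ t)
  let σ (k : ℕ) (c : ℕ × ℕ) : ℝ × ℝ := if h : good k c then h.choose else τ (gridParent k c)
  have hσ : ∀ k, GridFine a b δ (N + k) (σ k) := fun k c hc => by
    by_cases h : good k c
    · simp only [σ, dif_pos h]
      exact ⟨hIcc h.choose_spec.1.1, h.choose_spec.2.2⟩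
    · simp only [σ, dif_neg h]
      exact hτ.refine h₁ h₂ k c hc
  have hgood : ∀ k, η * μ {x | good k (gridIndex a b (N + k) x)} ≤ ENNReal.ofReal (ε + ε) :=
    fun k => by
    refine le_trans ?_ (hδ.lintegral_enorm_sub_le h₁ h₂ hδ (hτ.refine h₁ h₂ k) (hσ k))
    refine le_trans ?_ (mul_meas_ge_le_lintegral (stronglyMeasurable_comp_gridIndex
      fun c => f ((τ ∘ gridParent k) c) - f (σ k c)).enorm η)
    gcongr with x
    intro h
    simp only [Function.comp_apply, σ, dif_pos h]
    obtain ⟨⟨-, hle⟩, hpar, -⟩ := h.choose_spec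
    rwa [← hpar, edist_eq_enorm_sub] at hle
  let A (k : ℕ) : Set (ℝ × ℝ) := {x ∈ S | ∀ j ≥ k,
    gridCell a b (N + j) (gridIndex a b (N + j) x) ⊆ Metric.ball x (δ x)}
  have hA : Monotone A := fun k l hkl x hx => ⟨hx.1, fun j hj => hx.2 j (hkl.trans hj)⟩
  have hAS : S = ⋃ k, A k := by
    refine Subset.antisymm (fun x hx => ?_) (iUnion_subset fun k x hx => hx.1)
    obtain ⟨n, hn⟩ := Filter.eventually_atTop.1
      (eventually_gridCell_subset_ball (a := a) (b := b) (hg x (hIcc hx.1)))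
    exact mem_iUnion.2 ⟨n, hx, fun j hj => hn _ (by omega) _ _
      (gridIco_subset_gridCell (mem_gridIco_gridIndex h₁ h₂ (hIcc hx.1).1))⟩
  rw [hμ, Measure.restrict_apply' measurableSet_prodIco, inter_comm]
  change η * volume S ≤ _
  rw [hAS, hA.measure_iUnion, ENNReal.mul_iSup]
  refine iSup_le fun k => le_trans ?_ (hgood k)
  rw [hμ, Measure.restrict_apply' measurableSet_prodIco]
  gcongr
  exact fun x hx => ⟨⟨x, hx.1, gridParent_gridIndex, hx.2 k le_rfl⟩, hx.1.1⟩

/-- A strongly McShane integrable function on a rectangle is Bochner integrable, with the same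
integral. -/
theorem HasStrongMcShaneIntegral.integrableOn_and_integral_eq [CompleteSpace X] {v : X}
    (h₁ : a.1 < b.1) (h₂ : a.2 < b.2) (hf : HasStrongMcShaneIntegral a b f v) :
    IntegrableOn f (Icc a b) ∧ ∫ x in Icc a b, f x = v := by
  obtain ⟨F, hF, hFv, hFε⟩ := hf
  set e : ℕ → ℝ := fun n => 1 / ((n : ℝ) + 1)
  have he : ∀ n, 0 < e n := fun n => Nat.one_div_pos_of_nat
  have helim : Filter.Tendsto e Filter.atTop (𝓝 0) := tendsto_one_div_add_atTop_nhds_zero_nat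
  choose δ hg hδ using fun n => hFε (e n) (he n)
  replace hδ : ∀ n, IsStrongGauge a b f F (δ n) (e n) := hδ
  choose N τ hτ using fun n => (hg n).exists_gridFine h₁ h₂
  set μ := volume.restrict (prodIco a b) with hμ
  set φ : ℕ → ℝ × ℝ → X := fun n x => f (τ n (gridIndex a b (N n) x))
  have hφi : ∀ n, Integrable (φ n) μ := fun n =>
    integrableOn_comp_gridIndex h₁ h₂ fun c => f (τ n c)
  have hee : Filter.Tendsto (fun n => ENNReal.ofReal (e n + e n)) Filter.atTop (𝓝 0) := by
    simpa using ENNReal.tendsto_ofReal (helim.add helim)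
  have hmeas : TendstoInMeasure μ φ Filter.atTop f := by
    refine tendstoInMeasure_of_ne_top fun η hη hη' => ?_
    have hlim := ENNReal.Tendsto.const_mul (a := η⁻¹) hee (Or.inr (ENNReal.inv_ne_top.2 hη.ne'))
    rw [mul_zero] at hlim
    refine tendsto_of_tendsto_of_tendsto_of_le_of_le tendsto_const_nhds hlim
      (fun _ => zero_le) fun n => ?_
    exact (ENNReal.mul_le_iff_le_inv hη.ne' hη').1 ((hδ n).mul_measure_le h₁ h₂ (hg n) (hτ n) η)
  have hL1 : ∀ n, eLpNorm (φ n - f) 1 μ ≤ ENNReal.ofReal (e n + e n) := fun n => by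
    refine eLpNorm_le_of_tendstoInMeasure (u := Filter.atTop) (f := fun m => φ n - φ m) ?_ ?_
      fun m => (hφi n).1.sub (hφi m).1
    · filter_upwards [helim.eventually (gt_mem_nhds (he n))] with m hm
      rw [eLpNorm_one_eq_lintegral_enorm]
      exact ((hδ n).lintegral_enorm_sub_le' h₁ h₂ (hδ m) (hτ n) (hτ m)).trans
        (ENNReal.ofReal_le_ofReal (by linarith))
    · intro η hη
      simpa only [Pi.sub_apply, edist_sub_left] using hmeas η hη
  have hfm : AEStronglyMeasurable f μ := hmeas.aestronglyMeasurable fun n => (hφi n).1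
  have hfi : Integrable f μ := by
    have hd : Integrable (φ 0 - f) μ := memLp_one_iff_integrable.1
      ⟨(hφi 0).1.sub hfm, (hL1 0).trans_lt ENNReal.ofReal_lt_top⟩
    simpa using (hφi 0).sub hd
  have hint : Filter.Tendsto (fun n => ∫ x, φ n x ∂μ) Filter.atTop (𝓝 (∫ x, f x ∂μ)) := by
    refine tendsto_integral_of_L1 f hfi.1 (Filter.Eventually.of_forall hφi)
      (tendsto_of_tendsto_of_tendsto_of_le_of_le tendsto_const_nhds hee (fun _ => zero_le)
        fun n => ?_)
    rw [← eLpNorm_one_eq_lintegral_enorm]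
    exact hL1 n
  have hv : Filter.Tendsto (fun n => ∫ x, φ n x ∂μ) Filter.atTop (𝓝 v) := by
    rw [tendsto_iff_norm_sub_tendsto_zero]
    refine squeeze_zero (fun _ => norm_nonneg _) (fun n => ?_) helim
    rw [hμ, setIntegral_comp_gridIndex h₁ h₂ fun c => f (τ n c), ← hFv,
      hF.sum_grid h₁ h₂ (N n), ← Finset.sum_sub_distrib]
    exact (norm_sum_le _ _).trans ((hδ n).sum_grid_lt h₁ h₂ (hτ n)).le
  have hres : μ = volume.restrict (Icc a b) := Measure.restrict_congr_set prodIco_ae_eq_Icc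
  rw [IntegrableOn, ← hres]
  exact ⟨hfi, tendsto_nhds_unique hint hv⟩

end McShaneToBochner

/-- Theorem 2.1(ii): `g(t₁) = ∫_{[a₂,b₂]} (f₀)_{t₁}` is strongly
integrable on `[a₁,b₁]` and its integral equals `∫_{[a,b]} f = v`. -/
theorem fubini_main_mcShane_fst {X : Type*} [NormedAddCommGroup X] [NormedSpace ℝ X] [CompleteSpace X] (a₁ b₁ a₂ b₂ : ℝ) (hab₁ : a₁ < b₁) (hab₂ : a₂ < b₂)
    (f : ℝ × ℝ → X) (v : X)
    (hf : HasStrongMcShaneIntegral ((a₁, a₂) : ℝ × ℝ) (b₁, b₂) f v)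
    (Z₁ : Set ℝ) (hZ₁ : Z₁ = {t₁ : ℝ | t₁ ∈ Set.Icc a₁ b₁ ∧ ¬ ∃ u : X, HasStrongMcShaneIntegral a₂ b₂ (fun s₂ => f (t₁, s₂)) u})
    (Z₂ : Set ℝ) (hZ₂ : Z₂ = {t₂ : ℝ | t₂ ∈ Set.Icc a₂ b₂ ∧ ¬ ∃ u : X, HasStrongMcShaneIntegral a₁ b₁ (fun s₁ => f (s₁, t₂)) u})
    (Z : Set (ℝ × ℝ)) (hZ : Z = (Z₁ ×ˢ Set.Icc a₂ b₂) ∪ ((Set.Icc a₁ b₁) ×ˢ Z₂))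
    (f₀ : ℝ × ℝ → X) (hf₀ : f₀ = ((Set.Icc ((a₁, a₂) : ℝ × ℝ) (b₁, b₂)) \ Z).indicator f) :
    ∃ g : ℝ → X,
      (∀ t₁ ∈ Set.Icc a₁ b₁, HasStrongMcShaneIntegral a₂ b₂ (fun s₂ => f₀ (t₁, s₂)) (g t₁)) ∧
      HasStrongMcShaneIntegral a₁ b₁ g v := by
  obtain ⟨hfi, hfv⟩ := hf.integrableOn_and_integral_eq hab₁ hab₂
  set μ₁ := volume.restrict (Icc a₁ b₁) with hμ₁
  set μ₂ := volume.restrict (Icc a₂ b₂) with hμ₂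
  have hprod : volume.restrict (Icc ((a₁, a₂) : ℝ × ℝ) (b₁, b₂)) = μ₁.prod μ₂ := by
    rw [hμ₁, hμ₂, Measure.prod_restrict, Icc_prod_eq]
    rfl
  rw [IntegrableOn, hprod] at hfi
  rw [hprod, integral_prod f hfi] at hfv
  have hZ₂0 : ∀ᵐ s₂ ∂μ₂, s₂ ∉ Z₂ := by
    filter_upwards [hfi.prod_left_ae] with s₂ hs hmem
    rw [hZ₂] at hmem
    exact hmem.2 ⟨_, IntegrableOn.hasStrongMcShaneIntegral hs⟩
  have hzero : ∀ t₁ ∈ Z₁, ∀ s₂ ∈ Icc a₂ b₂, f₀ (t₁, s₂) = 0 := fun t₁ ht s₂ hs => by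
    rw [hf₀]
    refine indicator_of_notMem (fun h => h.2 ?_) _
    rw [hZ]
    exact Or.inl ⟨ht, hs⟩
  have hsection : ∀ t₁ ∈ Icc a₁ b₁, t₁ ∉ Z₁ →
      (fun s₂ => f (t₁, s₂)) =ᵐ[μ₂] fun s₂ => f₀ (t₁, s₂) := fun t₁ ht ht' => by
    filter_upwards [hZ₂0, ae_restrict_mem measurableSet_Icc] with s₂ hs hs'
    rw [hf₀, indicator_of_mem]
    refine ⟨⟨⟨ht.1, hs'.1⟩, ⟨ht.2, hs'.2⟩⟩, ?_⟩
    rw [hZ]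
    rintro (h | h)
    exacts [ht' h.1, hs h.2]
  have hex : ∀ t₁, ∃ u, (t₁ ∈ Icc a₁ b₁ →
      HasStrongMcShaneIntegral a₂ b₂ (fun s₂ => f₀ (t₁, s₂)) u) ∧
      (Integrable (fun s₂ => f (t₁, s₂)) μ₂ → ∫ s₂, f (t₁, s₂) ∂μ₂ = u) := fun t₁ => by
    by_cases hi : Integrable (fun s₂ => f (t₁, s₂)) μ₂
    · have hs := IntegrableOn.hasStrongMcShaneIntegral hi
      refine ⟨_, fun ht => hs.congr_ae (hsection t₁ ht fun h => ?_), fun _ => rfl⟩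
      rw [hZ₁] at h
      exact h.2 ⟨_, hs⟩
    by_cases ht : t₁ ∈ Icc a₁ b₁
    · by_cases hu : ∃ u, HasStrongMcShaneIntegral a₂ b₂ (fun s₂ => f (t₁, s₂)) u
      · obtain ⟨u, hu⟩ := hu
        refine ⟨u, fun _ => hu.congr_ae (hsection t₁ ht fun h => ?_), fun h => absurd h hi⟩
        rw [hZ₁] at h
        exact h.2 ⟨u, hu⟩
      · have h0 : (fun s₂ => f₀ (t₁, s₂)) =ᵐ[μ₂] 0 := by
          filter_upwards [ae_restrict_mem measurableSet_Icc] with s₂ hs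
          exact hzero t₁ (by rw [hZ₁]; exact ⟨ht, hu⟩) s₂ hs
        exact ⟨_, fun _ => IntegrableOn.hasStrongMcShaneIntegral
          ((integrable_zero ℝ X μ₂).congr h0.symm), fun h => absurd h hi⟩
    · exact ⟨0, fun h => absurd h ht, fun h => absurd h hi⟩
  choose g hg hgi using hex
  refine ⟨g, hg, ?_⟩
  have hgae : (fun t₁ => ∫ s₂, f (t₁, s₂) ∂μ₂) =ᵐ[μ₁] g := hfi.prod_right_ae.mono hgi
  rw [← hfv]
  exact (IntegrableOn.hasStrongMcShaneIntegral hfi.integral_prod_left).congr_ae hgae
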